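/- Let a > 0, 1 < μ < 2, V(x) = a|x|^{-μ}. Suppose (u_n) ⊂ H¹(ℝ³), (θ_n) ⊂ ℝ, (y_n) ⊂ ℝ³ are such that e^{-iθ_n} u_n(·+y_n) → Q in H¹(ℝ³), E_V(u_n) = E₀(Q) for all n, and ‖u_n‖²_{Ḣ¹_V} → ‖∇Q‖²_{L²}. Then ∫_{ℝ³} V(x)|u_n(x)|² dx → 0, and consequently ∫_{ℝ³} V(x)|Q(x − y_n)|² dx → 0, which forces |y_n| → ∞. -/

import Mathlib

open MeasureTheory Filter

noncomputable section

abbrev E3 := EuclideanSpace ℝ (Fin 3)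

/-- `∫ |∇f|²` for complex-valued `f`. -/
def gradSq (f : E3 → ℂ) : ℝ := ∫ x, ‖fderiv ℝ f x‖ ^ 2

/-- Potential energy `∫ a|x|^{-μ}|f|²`. -/
def pot (a μ : ℝ) (f : E3 → ℂ) : ℝ := ∫ x, a * ‖x‖ ^ (-μ) * ‖f x‖ ^ 2

/-- `‖f‖²_{L²}`. -/
def l2 (f : E3 → ℂ) : ℝ := ∫ x, ‖f x‖ ^ 2

/-- `‖f‖⁴_{L⁴}`. -/
def l4 (f : E3 → ℂ) : ℝ := ∫ x, ‖f x‖ ^ 4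

/-- `∫ |∇Q|²` for real-valued `Q`. -/
def gradSqR (Q : E3 → ℝ) : ℝ := ∫ x, ‖fderiv ℝ Q x‖ ^ 2

/-- `‖Q‖²_{L²}` for real-valued `Q`. -/
def l2R (Q : E3 → ℝ) : ℝ := ∫ x, (Q x) ^ 2

/-- `‖Q‖⁴_{L⁴}` for real-valued `Q`. -/
def l4R (Q : E3 → ℝ) : ℝ := ∫ x, (Q x) ^ 4

lemma int_of_sq {E : Type*} [NormedAddCommGroup E] {F G : E3 → E}
    (hFm : AEStronglyMeasurable F volume) (hGm : AEStronglyMeasurable G volume)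
    (hF : Integrable (fun x => ‖F x‖ ^ 2)) (hG : Integrable (fun x => ‖G x‖ ^ 2)) :
    Integrable (fun x => ‖F x - G x‖ ^ 2) := by
  have h1 := (memLp_two_iff_integrable_sq_norm hFm).2 hF
  have h2 := (memLp_two_iff_integrable_sq_norm hGm).2 hG
  exact (memLp_two_iff_integrable_sq_norm (hFm.sub hGm)).1 (h1.sub h2)

lemma bd1 (ε t s : ℝ) (hε : 0 < ε) (h : t ^ 2 + ε ≤ s) : |t / s| ≤ 1 + 1 / ε := by
  have hs : 0 < s := by nlinarith [sq_nonneg t]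
  rw [abs_div, abs_of_pos hs, div_le_iff₀ hs]
  have h1 : (1 + 1 / ε) * (t ^ 2 + ε) ≤ (1 + 1 / ε) * s := by gcongr
  have h2 : (1 + 1 / ε) * (t ^ 2 + ε) = t ^ 2 + 1 + ε + t ^ 2 / ε := by field_simp; ring
  have h3 : 0 ≤ t ^ 2 / ε := by positivity
  have h4 : |t| ≤ t ^ 2 + 1 := by
    rw [← sq_abs t]; nlinarith [sq_nonneg (|t| - 1), sq_nonneg (|t|)]
  linarith

lemma bd2 (ε t s : ℝ) (hε : 0 < ε) (h : t ^ 2 + ε ≤ s) :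
    |1 / s - 2 * t ^ 2 / s ^ 2| ≤ 3 / ε := by
  have hs : 0 < s := by nlinarith [sq_nonneg t]
  have h1 : 1 / s ≤ 1 / ε := one_div_le_one_div_of_le hε (by nlinarith [sq_nonneg t])
  have h2 : 2 * t ^ 2 / s ^ 2 ≤ 2 * (1 / s) := by
    rw [mul_one_div, div_le_div_iff₀ (by positivity) hs]
    nlinarith [mul_pos hs hs]
  have h3 : 0 ≤ 2 * t ^ 2 / s ^ 2 := by positivity
  have h4 : 0 < 1 / s := by positivity
  have h5 : 3 / ε = 3 * (1 / ε) := by ring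
  rw [abs_le, h5]
  constructor <;> linarith

lemma coord_sq_le (z : E3) (i : Fin 3) : (z i) ^ 2 ≤ ‖z‖ ^ 2 := by
  rw [EuclideanSpace.real_norm_sq_eq]
  exact Finset.single_le_sum (f := fun j => (z j) ^ 2) (fun j _ => sq_nonneg _) (Finset.mem_univ i)

lemma hardy_ibp (p : E3) (ε : ℝ) (hε : 0 < ε) (f : E3 → ℂ) (hf : Differentiable ℝ f)
    (hf2 : Integrable (fun x => ‖f x‖ ^ 2))
    (hfg : Integrable (fun x => ‖fderiv ℝ f x‖ ^ 2)) (i : Fin 3) :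
    Integrable (fun x => (1 / (‖x - p‖ ^ 2 + ε)
      - 2 * ((x - p) i) ^ 2 / (‖x - p‖ ^ 2 + ε) ^ 2) * ‖f x‖ ^ 2) ∧
    Integrable (fun x => ((x - p) i / (‖x - p‖ ^ 2 + ε)) *
      (2 * inner ℝ (f x) (fderiv ℝ f x (EuclideanSpace.single i (1:ℝ))))) ∧
    ∫ x, ((x - p) i / (‖x - p‖ ^ 2 + ε)) *
      (2 * inner ℝ (f x) (fderiv ℝ f x (EuclideanSpace.single i (1:ℝ)))) =
    - ∫ x, (1 / (‖x - p‖ ^ 2 + ε)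
      - 2 * ((x - p) i) ^ 2 / (‖x - p‖ ^ 2 + ε) ^ 2) * ‖f x‖ ^ 2 := by
  have hs : ∀ x : E3, ‖x - p‖ ^ 2 + ε ≠ 0 := fun x => by positivity
  have hsi : ∀ x : E3, ((x - p) i) ^ 2 + ε ≤ ‖x - p‖ ^ 2 + ε := fun x => by
    have := coord_sq_le (x - p) i
    linarith
  have hc : Continuous (fun x : E3 => (x - p) i) := by fun_prop
  have hfc := hf.continuous
  have c1 : Continuous (fun x : E3 => 1 / (‖x - p‖ ^ 2 + ε)
      - 2 * ((x - p) i) ^ 2 / (‖x - p‖ ^ 2 + ε) ^ 2) := by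
    refine Continuous.sub (Continuous.div (by fun_prop) (by fun_prop) hs)
      (Continuous.div (by fun_prop) (by fun_prop) fun x => pow_ne_zero 2 (hs x))
  have c2 : Continuous (fun x : E3 => (x - p) i / (‖x - p‖ ^ 2 + ε)) :=
    Continuous.div (by fun_prop) (by fun_prop) hs
  have i1 : Integrable (fun x => (1 / (‖x - p‖ ^ 2 + ε)
      - 2 * ((x - p) i) ^ 2 / (‖x - p‖ ^ 2 + ε) ^ 2) * ‖f x‖ ^ 2) :=
    hf2.bdd_mul (c := 3 / ε) c1.aestronglyMeasurable
      (Eventually.of_forall fun x => bd2 _ _ _ hε (hsi x))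
  have i0 : Integrable (fun x => 2 * inner ℝ (f x) 
      (fderiv ℝ f x (EuclideanSpace.single i (1:ℝ)))) := by
    refine (hf2.add hfg).mono' ?_ (Eventually.of_forall fun x => ?_)
    · have : Measurable (fun x => fderiv ℝ f x (EuclideanSpace.single i (1:ℝ))) :=
        measurable_fderiv_apply_const ℝ f _
      exact ((hfc.measurable.inner this).const_mul 2).aestronglyMeasurable
    · have h1 := norm_inner_le_norm (𝕜 := ℝ) (f x) (fderiv ℝ f x (EuclideanSpace.single i (1:ℝ)))
      have h2 := (fderiv ℝ f x).le_opNorm (EuclideanSpace.single i (1:ℝ))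
      rw [show ‖(EuclideanSpace.single i (1:ℝ) : E3)‖ = 1 by simp, mul_one] at h2
      simp only [norm_mul, Real.norm_ofNat, Pi.add_apply]
      have h3 : ‖f x‖ * ‖fderiv ℝ f x (EuclideanSpace.single i (1:ℝ))‖ ≤ ‖f x‖ * ‖fderiv ℝ f x‖ := by
        gcongr
      nlinarith [sq_nonneg (‖f x‖ - ‖fderiv ℝ f x‖)]
  have i2 : Integrable (fun x => ((x - p) i / (‖x - p‖ ^ 2 + ε)) *
      (2 * inner ℝ (f x) (fderiv ℝ f x (EuclideanSpace.single i (1:ℝ))))) :=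
    i0.bdd_mul (c := 1 + 1 / ε) c2.aestronglyMeasurable
      (Eventually.of_forall fun x => bd1 _ _ _ hε (hsi x))
  have i3 : Integrable (fun x => ((x - p) i / (‖x - p‖ ^ 2 + ε)) * ‖f x‖ ^ 2) :=
    hf2.bdd_mul (c := 1 + 1 / ε) c2.aestronglyMeasurable
      (Eventually.of_forall fun x => bd1 _ _ _ hε (hsi x))
  refine ⟨i1, i2, ?_⟩
  refine integral_bilinear_hasLineDerivAt_right_eq_neg_left_of_integrable
    (B := ContinuousLinearMap.mul ℝ ℝ) (v := EuclideanSpace.single i (1:ℝ)) i1 i2 i3 ?_ ?_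
  · intro x _
    have hn : HasFDerivAt (fun x : E3 => ‖x - p‖ ^ 2 + ε) _ x :=
      (((hasFDerivAt_id x).sub_const p).norm_sq).add_const ε
    have hcc : HasFDerivAt (fun x : E3 => (x - p) i) (EuclideanSpace.proj (𝕜 := ℝ) i : E3 →L[ℝ] ℝ) x := by
      have := (EuclideanSpace.proj (𝕜 := ℝ) i : E3 →L[ℝ] ℝ).hasFDerivAt.comp x
        ((hasFDerivAt_id x).sub_const p)
      exact this
    have := (hcc.hasLineDerivAt (EuclideanSpace.single i (1:ℝ)))
    have h2 := (hn.hasLineDerivAt (EuclideanSpace.single i (1:ℝ)))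
    unfold HasLineDerivAt at this h2 ⊢
    have h3 := this.div h2 (by simpa using hs x)
    convert! h3 using 1
    have := hs x
    simp [EuclideanSpace.inner_single_right]
    field_simp
    try ring
  · intro x _
    have := (hf x).hasFDerivAt.norm_sq.hasLineDerivAt (EuclideanSpace.single i (1:ℝ))
    convert! this using 1
    simp [mul_add]

lemma hardy (p : E3) (ε : ℝ) (hε : 0 < ε) (f : E3 → ℂ) (hf : Differentiable ℝ f)
    (hf2 : Integrable (fun x => ‖f x‖ ^ 2))
    (hfg : Integrable (fun x => ‖fderiv ℝ f x‖ ^ 2)) :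
    Integrable (fun x => (‖x - p‖ ^ 2 + ε)⁻¹ * ‖f x‖ ^ 2) ∧
    ∫ x, (‖x - p‖ ^ 2 + ε)⁻¹ * ‖f x‖ ^ 2 ≤ 4 * ∫ x, ‖fderiv ℝ f x‖ ^ 2 := by
  have hs : ∀ x : E3, 0 < ‖x - p‖ ^ 2 + ε := fun x => by positivity
  have iW : Integrable (fun x => (‖x - p‖ ^ 2 + ε)⁻¹ * ‖f x‖ ^ 2) := by
    refine hf2.bdd_mul (c := ε⁻¹) ?_ (Eventually.of_forall fun x => ?_)
    · exact (Continuous.inv₀ (by fun_prop) fun x => (hs x).ne').aestronglyMeasurable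
    · rw [Real.norm_of_nonneg (inv_nonneg.2 (hs x).le)]
      exact inv_anti₀ hε (by nlinarith [sq_nonneg ‖x - p‖])
  refine ⟨iW, ?_⟩
  have H := hardy_ibp p ε hε f hf hf2 hfg
  have hr : ∀ x : E3, ∑ i : Fin 3, ((x - p) i) ^ 2 = ‖x - p‖ ^ 2 := fun x =>
    (EuclideanSpace.real_norm_sq_eq _).symm
  have e1 : ∫ x, (‖x - p‖ ^ 2 + ε)⁻¹ * ‖f x‖ ^ 2 ≤ ∑ i : Fin 3, ∫ x, (1 / (‖x - p‖ ^ 2 + ε)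
      - 2 * ((x - p) i) ^ 2 / (‖x - p‖ ^ 2 + ε) ^ 2) * ‖f x‖ ^ 2 := by
    rw [← integral_finsetSum _ fun i _ => (H i).1]
    refine integral_mono iW (integrable_finsetSum _ fun i _ => (H i).1) fun x => ?_
    simp only
    rw [← Finset.sum_mul]
    gcongr
    rw [Finset.sum_sub_distrib, ← Finset.sum_div, ← Finset.sum_div, ← Finset.mul_sum, hr]
    simp only [Finset.sum_const, Finset.card_univ, Fintype.card_fin, nsmul_eq_mul]
    have h := hs x
    have : 2 * ‖x - p‖ ^ 2 / (‖x - p‖ ^ 2 + ε) ^ 2 ≤ 2 * (‖x - p‖ ^ 2 + ε)⁻¹ := by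
      rw [← div_eq_mul_inv, div_le_div_iff₀ (by positivity) h]
      nlinarith
    have h3 : ((3 : ℕ) : ℝ) * 1 / (‖x - p‖ ^ 2 + ε) = 3 * (‖x - p‖ ^ 2 + ε)⁻¹ := by
      push_cast; ring
    rw [h3]
    linarith
  have e2 : ∑ i : Fin 3, ∫ x, (1 / (‖x - p‖ ^ 2 + ε)
      - 2 * ((x - p) i) ^ 2 / (‖x - p‖ ^ 2 + ε) ^ 2) * ‖f x‖ ^ 2 ≤
      ∫ x, ((1/2) * ((‖x - p‖ ^ 2 + ε)⁻¹ * ‖f x‖ ^ 2) + 2 * ‖fderiv ℝ f x‖ ^ 2) := by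
    have : ∀ i : Fin 3, ∫ x, (1 / (‖x - p‖ ^ 2 + ε)
      - 2 * ((x - p) i) ^ 2 / (‖x - p‖ ^ 2 + ε) ^ 2) * ‖f x‖ ^ 2 =
      ∫ x, -(((x - p) i / (‖x - p‖ ^ 2 + ε)) *
      (2 * inner ℝ (f x) (fderiv ℝ f x (EuclideanSpace.single i (1:ℝ))))) := fun i => by
      rw [integral_neg, (H i).2.2, neg_neg]
    have iN : ∀ i ∈ (Finset.univ : Finset (Fin 3)),
      Integrable (fun x => -(((x - p) i / (‖x - p‖ ^ 2 + ε)) *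
      (2 * inner ℝ (f x) (fderiv ℝ f x (EuclideanSpace.single i (1:ℝ)))))) :=
      fun i _ => (H i).2.1.neg
    rw [Finset.sum_congr rfl fun i _ => this i, ← integral_finsetSum _ iN]
    refine integral_mono (integrable_finsetSum _ iN)
      ((iW.const_mul _).add (hfg.const_mul _)) fun x => ?_
    simp only
    have hx : ∑ i : Fin 3, ((x - p) i) • (EuclideanSpace.single i (1:ℝ) : E3) = x - p := by
      ext j
      fin_cases j <;> simp [Fin.sum_univ_three]
    have : ∑ i : Fin 3, -(((x - p) i / (‖x - p‖ ^ 2 + ε)) *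
      (2 * inner ℝ (f x) (fderiv ℝ f x (EuclideanSpace.single i (1:ℝ))))) =
      - (2 / (‖x - p‖ ^ 2 + ε) * inner ℝ (f x) (fderiv ℝ f x (x - p))) := by
      have hfx : fderiv ℝ f x (x - p) = ∑ i : Fin 3, ((x - p) i) •
          fderiv ℝ f x (EuclideanSpace.single i (1:ℝ)) := by
        conv_lhs => rw [← hx]
        rw [map_sum]
        exact Finset.sum_congr rfl fun i _ => map_smul _ _ _
      rw [hfx, inner_sum, Finset.mul_sum, ← Finset.sum_neg_distrib]
      refine Finset.sum_congr rfl fun i _ => ?_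
      rw [inner_smul_right]
      ring
    rw [this]
    have h1 := norm_inner_le_norm (𝕜 := ℝ) (f x) (fderiv ℝ f x (x - p))
    have h2 := (fderiv ℝ f x).le_opNorm (x - p)
    rw [Real.norm_eq_abs] at h1
    have h3 := (abs_le.1 h1).1
    have h := hs x
    set s := ‖x - p‖ ^ 2 + ε with hsd
    set r := ‖x - p‖
    have h4 : ‖f x‖ * ‖fderiv ℝ f x (x - p)‖ ≤ ‖f x‖ * (‖fderiv ℝ f x‖ * r) := by gcongr
    have h5 : -(2 / s * inner ℝ (f x) (fderiv ℝ f x (x - p))) ≤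
        2 / s * (‖f x‖ * (‖fderiv ℝ f x‖ * r)) := by
      rw [← mul_neg]; gcongr; linarith
    have h6 : (r / s) ^ 2 ≤ s⁻¹ := by
      rw [div_pow, ← one_div, div_le_div_iff₀ (by positivity) h]
      nlinarith
    have h7 : 2 / s * (‖f x‖ * (‖fderiv ℝ f x‖ * r)) = 2 * (‖f x‖ * (r / s)) * ‖fderiv ℝ f x‖ := by
      ring
    have h8 : (r / s) ^ 2 * ‖f x‖ ^ 2 ≤ s⁻¹ * ‖f x‖ ^ 2 := by gcongr
    nlinarith [sq_nonneg (‖f x‖ * (r / s) - 2 * ‖fderiv ℝ f x‖)]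
  rw [integral_add (iW.const_mul _) (hfg.const_mul _), integral_const_mul, integral_const_mul] at e2
  linarith

lemma l2_tri {E : Type*} [NormedAddCommGroup E] {F G H : E3 → E}
    (hF : Integrable (fun x => ‖F x - G x‖ ^ 2)) (hH : Integrable (fun x => ‖H x - G x‖ ^ 2))
    (hFH : Integrable (fun x => ‖F x - H x‖ ^ 2)) :
    ∫ x, ‖F x - H x‖ ^ 2 ≤ 2 * (∫ x, ‖F x - G x‖ ^ 2) + 2 * ∫ x, ‖H x - G x‖ ^ 2 := by
  rw [← integral_const_mul, ← integral_const_mul,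
    ← integral_add (hF.const_mul _) (hH.const_mul _)]
  refine integral_mono hFH ((hF.const_mul _).add (hH.const_mul _)) fun x => ?_
  have h : ‖F x - H x‖ ≤ ‖F x - G x‖ + ‖H x - G x‖ := by
    rw [show F x - H x = (F x - G x) - (H x - G x) by abel]
    exact norm_sub_le _ _
  simp only
  have h2 := pow_le_pow_left₀ (norm_nonneg _) h 2
  nlinarith [sq_nonneg (‖F x - G x‖ - ‖H x - G x‖)]

lemma eLpNorm_two {E : Type*} [NormedAddCommGroup E] {F : E3 → E}
    (hFm : AEStronglyMeasurable F volume) (hF : Integrable (fun x => ‖F x‖ ^ 2)) :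
    eLpNorm F 2 volume = ENNReal.ofReal (Real.sqrt (∫ x, ‖F x‖ ^ 2)) := by
  rw [((memLp_two_iff_integrable_sq_norm hFm).2 hF).eLpNorm_eq_integral_rpow_norm
    (by norm_num) (by norm_num), Real.sqrt_eq_rpow]
  simp

lemma l2_tendsto {E : Type*} [NormedAddCommGroup E] {F : ℕ → E3 → E} {G : E3 → E}
    (hFm : ∀ n, AEStronglyMeasurable (F n) volume) (hGm : AEStronglyMeasurable G volume)
    (hF : ∀ n, Integrable (fun x => ‖F n x‖ ^ 2)) (hG : Integrable (fun x => ‖G x‖ ^ 2))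
    (h : Tendsto (fun n => ∫ x, ‖F n x - G x‖ ^ 2) atTop (nhds 0)) :
    Tendsto (fun n => ∫ x, ‖F n x‖ ^ 2) atTop (nhds (∫ x, ‖G x‖ ^ 2)) := by
  have key : ∀ A B : E3 → E, AEStronglyMeasurable A volume → AEStronglyMeasurable B volume →
      Integrable (fun x => ‖A x‖ ^ 2) → Integrable (fun x => ‖B x‖ ^ 2) →
      Real.sqrt (∫ x, ‖A x‖ ^ 2) ≤ Real.sqrt (∫ x, ‖B x‖ ^ 2) + 
        Real.sqrt (∫ x, ‖A x - B x‖ ^ 2) := by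
    intro A B hA hB iA iB
    have h1 := eLpNorm_add_le (p := 2) hB (hA.sub hB) (by norm_num)
    rw [add_sub_cancel, eLpNorm_two hA iA, eLpNorm_two hB iB,
      eLpNorm_two (hA.sub hB) (int_of_sq hA hB iA iB),
      ← ENNReal.ofReal_add (Real.sqrt_nonneg _) (Real.sqrt_nonneg _)] at h1
    exact (ENNReal.ofReal_le_ofReal_iff (by positivity)).1 h1
  have hs : Tendsto (fun n => Real.sqrt (∫ x, ‖F n x - G x‖ ^ 2)) atTop (nhds 0) := by
    simpa using h.sqrt
  have h2 : Tendsto (fun n => Real.sqrt (∫ x, ‖F n x‖ ^ 2)) atTop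
      (nhds (Real.sqrt (∫ x, ‖G x‖ ^ 2))) := by
    rw [tendsto_iff_dist_tendsto_zero]
    refine squeeze_zero (fun _ => dist_nonneg) (fun n => ?_) hs
    rw [Real.dist_eq, abs_le]
    have k1 := key _ _ (hFm n) hGm (hF n) hG
    have k2 := key _ _ hGm (hFm n) hG (hF n)
    simp_rw [norm_sub_rev (G _)] at k2
    constructor <;> linarith
  have h3 := h2.pow 2
  have hn : ∀ f : E3 → E, Real.sqrt (∫ x, ‖f x‖ ^ 2) ^ 2 = ∫ x, ‖f x‖ ^ 2 := fun f =>
    Real.sq_sqrt (integral_nonneg fun x => by positivity)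
  simpa only [hn] using h3

lemma key (v : ℕ → E3 → ℂ) (q : E3 → ℂ) (G : E3 → E3 →L[ℝ] ℂ)
    (hv : ∀ n, Differentiable ℝ (v n)) (hq : Continuous q)
    (hGm : AEStronglyMeasurable G volume)
    (hv2 : ∀ n, Integrable (fun x => ‖v n x‖ ^ 2))
    (hvg : ∀ n, Integrable (fun x => ‖fderiv ℝ (v n) x‖ ^ 2))
    (hq2 : Integrable (fun x => ‖q x‖ ^ 2))
    (hGg : Integrable (fun x => ‖G x‖ ^ 2))
    (h0 : Tendsto (fun n => ∫ x, ‖v n x - q x‖ ^ 2) atTop (nhds 0))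
    (h1 : Tendsto (fun n => ∫ x, ‖fderiv ℝ (v n) x - G x‖ ^ 2) atTop (nhds 0))
    (n : ℕ) (p : E3) :
    Integrable (fun x => (‖x - p‖ ^ 2)⁻¹ * ‖v n x - q x‖ ^ 2) ∧
    ∫ x, (‖x - p‖ ^ 2)⁻¹ * ‖v n x - q x‖ ^ 2 ≤ 8 * ∫ x, ‖fderiv ℝ (v n) x - G x‖ ^ 2 := by
  have hvm : ∀ n, AEStronglyMeasurable (v n) volume := fun n =>
    (hv n).continuous.aestronglyMeasurable
  have hdm : ∀ n, AEStronglyMeasurable (fderiv ℝ (v n)) volume := fun n =>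
    (measurable_fderiv ℝ (v n)).aestronglyMeasurable
  have hqm := hq.aestronglyMeasurable (μ := (volume : Measure E3))
  have hT : TendstoInMeasure volume v atTop q := by
    refine tendstoInMeasure_of_tendsto_eLpNorm (p := 2) (by norm_num) hvm hqm ?_
    have : ∀ n, eLpNorm (v n - q) 2 volume =
        ENNReal.ofReal (Real.sqrt (∫ x, ‖v n x - q x‖ ^ 2)) := fun n =>
      eLpNorm_two ((hvm n).sub hqm) (int_of_sq (hvm n) hqm (hv2 n) hq2)
    simp_rw [this]
    have := (ENNReal.continuous_ofReal.tendsto _).comp h0.sqrt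
    simpa using! this
  obtain ⟨ns, hns, hae⟩ := hT.exists_seq_tendsto_ae
  set D : ℕ → ℝ := fun n => ∫ x, ‖fderiv ℝ (v n) x - G x‖ ^ 2 with hD
  let F : ℕ → E3 → ENNReal := fun m x => ENNReal.ofReal
    ((‖x - p‖ ^ 2 + 1 / ((m : ℝ) + 1))⁻¹ * ‖v n x - v (ns m) x‖ ^ 2)
  have hFi : ∀ m, ∫⁻ x, F m x ≤ ENNReal.ofReal (8 * D n + 8 * D (ns m)) := by
    intro m
    have hdd : ∀ x, fderiv ℝ (fun x => v n x - v (ns m) x) x =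
        fderiv ℝ (v n) x - fderiv ℝ (v (ns m)) x := fun x =>
      fderiv_fun_sub (hv n x) (hv (ns m) x)
    have i1 := int_of_sq (hdm n) (hdm (ns m)) (hvg n) (hvg (ns m))
    have H := hardy p (1 / ((m : ℝ) + 1)) (by positivity) (fun x => v n x - v (ns m) x)
      ((hv n).sub (hv _)) (int_of_sq (hvm n) (hvm _) (hv2 n) (hv2 _)) (by simpa only [hdd] using i1)
    rw [← ofReal_integral_eq_lintegral_ofReal H.1 (Eventually.of_forall fun x => by
      simp only [Pi.zero_apply]; positivity)]
    refine ENNReal.ofReal_le_ofReal (H.2.trans ?_)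
    simp_rw [hdd]
    have := l2_tri (int_of_sq (hdm n) hGm (hvg n) hGg) (int_of_sq (hdm (ns m)) hGm (hvg _) hGg) i1
    simp only [hD]
    linarith
  have hne : ∀ᵐ x : E3, x ≠ p := by
    simp [ae_iff]
  have hlim : ∀ᵐ x, Tendsto (fun m => F m x) atTop
      (nhds (ENNReal.ofReal ((‖x - p‖ ^ 2)⁻¹ * ‖v n x - q x‖ ^ 2))) := by
    filter_upwards [hae, hne] with x hx hxp
    refine (ENNReal.continuous_ofReal.tendsto _).comp ?_
    refine Tendsto.mul (Tendsto.inv₀ ?_ ?_) ((tendsto_const_nhds.sub hx).norm.pow 2)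
    · simpa using tendsto_const_nhds.add (tendsto_one_div_add_atTop_nhds_zero_nat (𝕜 := ℝ))
    · exact pow_ne_zero 2 (norm_ne_zero_iff.2 (sub_ne_zero.2 hxp))
  have hFm : ∀ m, Measurable (F m) := fun m => by
    have := (hv n).continuous.measurable
    have := (hv (ns m)).continuous.measurable
    fun_prop
  have hL : ∫⁻ x, ENNReal.ofReal ((‖x - p‖ ^ 2)⁻¹ * ‖v n x - q x‖ ^ 2) ≤
      ENNReal.ofReal (8 * D n) := by
    calc _ = ∫⁻ x, liminf (fun m => F m x) atTop :=
          lintegral_congr_ae (hlim.mono fun x hx => hx.liminf_eq.symm)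
      _ ≤ liminf (fun m => ∫⁻ x, F m x) atTop := lintegral_liminf_le hFm
      _ ≤ liminf (fun m => ENNReal.ofReal (8 * D n + 8 * D (ns m))) atTop :=
          liminf_le_liminf (Eventually.of_forall hFi)
      _ = _ := by
          refine Tendsto.liminf_eq ((ENNReal.continuous_ofReal.tendsto _).comp ?_)
          have := ((h1.comp hns.tendsto_atTop).const_mul 8).const_add (8 * D n)
          simpa using! this
  have hD0 : 0 ≤ D n := integral_nonneg fun x => by positivity
  have hnn : ∀ x, 0 ≤ (‖x - p‖ ^ 2)⁻¹ * ‖v n x - q x‖ ^ 2 := fun x => by positivity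
  have hm : AEStronglyMeasurable (fun x => (‖x - p‖ ^ 2)⁻¹ * ‖v n x - q x‖ ^ 2) volume := by
    have := (hv n).continuous.measurable
    have := hq.measurable
    exact Measurable.aestronglyMeasurable (by fun_prop)
  refine ⟨⟨hm, ?_⟩, ?_⟩
  · rw [hasFiniteIntegral_iff_ofReal (Eventually.of_forall hnn)]
    exact hL.trans_lt ENNReal.ofReal_lt_top
  · rw [integral_eq_lintegral_of_nonneg_ae (Eventually.of_forall hnn) hm]
    exact ENNReal.toReal_le_of_le_ofReal (by positivity) hL

lemma norm_fderiv_ofReal (Q : E3 → ℝ) (x : E3) :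
    ‖fderiv ℝ (fun z => ((Q z : ℝ) : ℂ)) x‖ = ‖fderiv ℝ Q x‖ := by
  by_cases h : DifferentiableAt ℝ Q x
  · have h1 : HasFDerivAt (fun z => ((Q z : ℝ) : ℂ)) (Complex.ofRealCLM.comp (fderiv ℝ Q x)) x :=
      Complex.ofRealCLM.hasFDerivAt.comp x h.hasFDerivAt
    rw [h1.fderiv]
    exact Complex.ofRealLI.norm_toContinuousLinearMap_comp
  · have h2 : ¬ DifferentiableAt ℝ (fun z => ((Q z : ℝ) : ℂ)) x := fun h3 => h (by
      have := Complex.reCLM.differentiableAt.comp x h3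
      simpa using! this)
    rw [fderiv_zero_of_not_differentiableAt h, fderiv_zero_of_not_differentiableAt h2]
    simp

lemma rpow_bound (μ r : ℝ) (hμ1 : 1 < μ) (hμ2 : μ < 2) (hr : 0 ≤ r) :
    r ^ (-μ) ≤ 1 + (r ^ 2)⁻¹ := by
  rcases hr.eq_or_lt with rfl | hr
  · rw [Real.zero_rpow (by linarith)]; positivity
  rcases le_total 1 r with h | h
  · have := Real.rpow_le_one_of_one_le_of_nonpos h (by linarith : -μ ≤ 0)
    have h2 : 0 ≤ (r ^ 2)⁻¹ := by positivity
    linarith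
  · have := Real.rpow_le_rpow_of_exponent_ge hr h (by linarith : (-2 : ℝ) ≤ -μ)
    rw [Real.rpow_neg hr.le 2, Real.rpow_two] at this
    linarith

lemma sq_add_bound (c z : ℂ) (t : ℝ) (hc : ‖c‖ = 1) :
    t ^ 2 ≤ 2 * ‖z‖ ^ 2 + 2 * ‖c * z - (t : ℂ)‖ ^ 2 := by
  have h : ‖(t : ℂ)‖ ≤ ‖z‖ + ‖c * z - (t : ℂ)‖ := by
    have := norm_sub_le (c * z) (c * z - (t : ℂ))
    rwa [sub_sub_cancel, norm_mul, hc, one_mul] at this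
  have h2 := pow_le_pow_left₀ (norm_nonneg _) h 2
  rw [Complex.norm_real, Real.norm_eq_abs, sq_abs] at h2
  nlinarith [sq_nonneg (‖z‖ - ‖c * z - (t : ℂ)‖)]

lemma final_step (a μ : ℝ) (ha : 0 < a) (hμ1 : 1 < μ)
    (Q : E3 → ℝ) (hQpos : ∀ x, 0 < Q x)
    (hQ2 : Integrable (fun x => (Q x) ^ 2)) (y : ℕ → E3)
    (hi : ∀ n, Integrable (fun x => a * ‖x + y n‖ ^ (-μ) * (Q x) ^ 2))
    (h : Tendsto (fun n => ∫ x, a * ‖x + y n‖ ^ (-μ) * (Q x) ^ 2) atTop (nhds 0)) :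
    Tendsto (fun n => ‖y n‖) atTop atTop := by
  rw [tendsto_atTop]
  intro R
  set T := max R 1 with hT
  have hT1 : 1 ≤ T := le_max_right _ _
  have hpos : 0 < ∫ x in Metric.ball (0 : E3) 1, (Q x) ^ 2 := by
    rw [setIntegral_pos_iff_support_of_nonneg_ae
      (Eventually.of_forall fun x => by simp only [Pi.zero_apply]; positivity) hQ2.integrableOn]
    have : Function.support (fun x => (Q x) ^ 2) = Set.univ := by
      ext x; simp [(hQpos x).ne']
    rw [this, Set.univ_inter]
    exact Metric.measure_ball_pos _ _ one_pos
  have hc : 0 < a * (1 + T) ^ (-μ) * ∫ x in Metric.ball (0 : E3) 1, (Q x) ^ 2 := by positivity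
  filter_upwards [h.eventually_lt_const hc] with n hn
  by_contra! hlt
  have hyT : ‖y n‖ ≤ T := hlt.le.trans (le_max_left _ _)
  refine absurd hn (not_lt.2 ?_)
  rw [← integral_const_mul]
  refine le_trans ?_ (setIntegral_le_integral (s := Metric.ball (0 : E3) 1) (hi n)
    (Eventually.of_forall fun x => by simp only [Pi.zero_apply]; positivity))
  refine setIntegral_mono_on_ae (hQ2.const_mul _).integrableOn (hi n).integrableOn
    measurableSet_ball ?_
  have hne : ∀ᵐ x : E3, x ≠ - y n := by simp [ae_iff]
  filter_upwards [hne] with x hx hxb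
  have hx0 : 0 < ‖x + y n‖ := norm_pos_iff.2 fun h0 => hx (eq_neg_of_add_eq_zero_left h0)
  have hx1 : ‖x + y n‖ ≤ 1 + T := by
    have := norm_add_le x (y n)
    rw [mem_ball_zero_iff] at hxb
    linarith
  have := Real.rpow_le_rpow_of_nonpos hx0 hx1 (by linarith : -μ ≤ 0)
  gcongr

/-- If `e^{-iθ_n}u_n(·+y_n) → Q` in `H¹`, `E_V(u_n) = E₀(Q)` and
`‖u_n‖²_{Ḣ¹_V} → ‖∇Q‖²_{L²}`, then `∫V|u_n|² → 0`, `∫V(x)Q(x−y_n)²dx → 0` and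
`|y_n| → ∞`. -/
theorem stmt19 (a μ : ℝ) (ha : 0 < a) (hμ1 : 1 < μ) (hμ2 : μ < 2)
    (Q : E3 → ℝ) (hQpos : ∀ x, 0 < Q x) (hQcont : Continuous Q)
    (hQ2 : Integrable (fun x => (Q x) ^ 2))
    (hQ4 : Integrable (fun x => (Q x) ^ 4))
    (hQg : Integrable (fun x => ‖fderiv ℝ Q x‖ ^ 2))
    (u : ℕ → E3 → ℂ) (θ : ℕ → ℝ) (y : ℕ → E3)
    (hud : ∀ n, Differentiable ℝ (u n))
    (hu2 : ∀ n, Integrable (fun x => ‖u n x‖ ^ 2))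
    (hu4 : ∀ n, Integrable (fun x => ‖u n x‖ ^ 4))
    (hug : ∀ n, Integrable (fun x => ‖fderiv ℝ (u n) x‖ ^ 2))
    (hup : ∀ n, Integrable (fun x => a * ‖x‖ ^ (-μ) * ‖u n x‖ ^ 2))
    -- convergence `e^{-iθ_n} u_n(·+y_n) → Q` in `H¹(ℝ³)`
    (hconv : Tendsto (fun n =>
        (∫ x, ‖Complex.exp (-Complex.I * (θ n : ℂ)) * u n (x + y n) - ((Q x : ℝ) : ℂ)‖ ^ 2)
        + ∫ x, ‖fderiv ℝ (fun z => Complex.exp (-Complex.I * (θ n : ℂ)) * u n (z + y n)) x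
            - fderiv ℝ (fun z => ((Q z : ℝ) : ℂ)) x‖ ^ 2) atTop (nhds 0))
    -- E_V(u_n) = E₀(Q) for all n
    (hE : ∀ n, (1 / 2 : ℝ) * (gradSq (u n) + pot a μ (u n)) - (1 / 4) * l4 (u n)
        = (1 / 2) * gradSqR Q - (1 / 4) * l4R Q)
    -- ‖u_n‖²_{Ḣ¹_V} → ‖∇Q‖²_{L²}
    (hH : Tendsto (fun n => gradSq (u n) + pot a μ (u n)) atTop (nhds (gradSqR Q))) :
    Tendsto (fun n => pot a μ (u n)) atTop (nhds 0)
    ∧ Tendsto (fun n => ∫ x, a * ‖x‖ ^ (-μ) * (Q (x - y n)) ^ 2) atTop (nhds 0)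
    ∧ Tendsto (fun n => ‖y n‖) atTop atTop := by
  set c : ℕ → ℂ := fun n => Complex.exp (-Complex.I * (θ n : ℂ)) with hc
  have hc1 : ∀ n, ‖c n‖ = 1 := fun n => by
    have : -Complex.I * (θ n : ℂ) = ((-θ n : ℝ) : ℂ) * Complex.I := by push_cast; ring
    simp only [hc]
    rw [this, Complex.norm_exp_ofReal_mul_I]
  set v : ℕ → E3 → ℂ := fun n z => c n * u n (z + y n) with hv
  set q : E3 → ℂ := fun z => ((Q z : ℝ) : ℂ) with hq
  have hvn : ∀ n x, ‖v n x‖ = ‖u n (x + y n)‖ := fun n x => by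
    simp only [hv, norm_mul, hc1, one_mul]
  have hvd : ∀ n, Differentiable ℝ (v n) := fun n => by
    have := (hud n).comp (differentiable_id.add_const (y n))
    exact this.const_mul (c n)
  have hvdn : ∀ n x, ‖fderiv ℝ (v n) x‖ = ‖fderiv ℝ (u n) (x + y n)‖ := fun n x => by
    have h1 : DifferentiableAt ℝ (fun z => u n (z + y n)) x :=
      ((hud n).comp (differentiable_id.add_const (y n))) x
    simp only [hv]
    rw [fderiv_const_mul h1, fderiv_comp_add_right, norm_smul, hc1, one_mul]
  have hqc : Continuous q := Complex.continuous_ofReal.comp hQcont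
  have hqn : ∀ x, ‖q x‖ ^ 2 = Q x ^ 2 := fun x => by
    simp only [hq, Complex.norm_real, Real.norm_eq_abs, sq_abs]
  have hGm : AEStronglyMeasurable (fderiv ℝ q) volume :=
    (measurable_fderiv ℝ q).aestronglyMeasurable
  have hGn : ∀ x, ‖fderiv ℝ q x‖ = ‖fderiv ℝ Q x‖ := norm_fderiv_ofReal Q
  have hv2 : ∀ n, Integrable (fun x => ‖v n x‖ ^ 2) := fun n => by
    simp only [hvn]; exact (hu2 n).comp_add_right (y n)
  have hvg : ∀ n, Integrable (fun x => ‖fderiv ℝ (v n) x‖ ^ 2) := fun n => by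
    simp only [hvdn]; exact (hug n).comp_add_right (y n)
  have hq2 : Integrable (fun x => ‖q x‖ ^ 2) := by simpa only [hqn] using hQ2
  have hGg : Integrable (fun x => ‖fderiv ℝ q x‖ ^ 2) := by simpa only [hGn] using hQg
  have hA0 : ∀ n, 0 ≤ ∫ x, ‖v n x - q x‖ ^ 2 := fun n => integral_nonneg fun x => by positivity
  have hB0 : ∀ n, 0 ≤ ∫ x, ‖fderiv ℝ (v n) x - fderiv ℝ q x‖ ^ 2 := fun n =>
    integral_nonneg fun x => by positivity
  have hA : Tendsto (fun n => ∫ x, ‖v n x - q x‖ ^ 2) atTop (nhds 0) :=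
    squeeze_zero hA0 (fun n => le_add_of_nonneg_right (hB0 n)) hconv
  have hB : Tendsto (fun n => ∫ x, ‖fderiv ℝ (v n) x - fderiv ℝ q x‖ ^ 2) atTop (nhds 0) :=
    squeeze_zero hB0 (fun n => le_add_of_nonneg_left (hA0 n)) hconv
  have hgrad : Tendsto (fun n => gradSq (u n)) atTop (nhds (gradSqR Q)) := by
    have := l2_tendsto (fun n => (measurable_fderiv ℝ (v n)).aestronglyMeasurable) hGm hvg hGg hB
    have e1 : ∀ n, ∫ x, ‖fderiv ℝ (v n) x‖ ^ 2 = gradSq (u n) := fun n => by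
      simp only [hvdn, gradSq]
      exact integral_add_right_eq_self (fun x => ‖fderiv ℝ (u n) x‖ ^ 2) (y n)
    simpa only [e1, hGn, gradSqR] using this
  have hpot : Tendsto (fun n => pot a μ (u n)) atTop (nhds 0) := by
    simpa using hH.sub hgrad
  have iU : ∀ n, Integrable (fun x => a * ‖x + y n‖ ^ (-μ) * ‖u n (x + y n)‖ ^ 2) := fun n =>
    (hup n).comp_add_right (y n)
  have eU : ∀ n, ∫ x, a * ‖x + y n‖ ^ (-μ) * ‖u n (x + y n)‖ ^ 2 = pot a μ (u n) := fun n =>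
    integral_add_right_eq_self (fun x => a * ‖x‖ ^ (-μ) * ‖u n x‖ ^ 2) (y n)
  have K := fun n => key v q (fderiv ℝ q) hvd hqc hGm hv2 hvg hq2 hGg hA hB n (- y n)
  simp only [sub_neg_eq_add] at K
  have iA : ∀ n, Integrable (fun x => ‖v n x - q x‖ ^ 2) := fun n =>
    int_of_sq (hvd n).continuous.aestronglyMeasurable hqc.aestronglyMeasurable (hv2 n) hq2
  have iR : ∀ n, Integrable (fun x => 2 * (a * ‖x + y n‖ ^ (-μ) * ‖u n (x + y n)‖ ^ 2) +
      2 * a * (‖v n x - q x‖ ^ 2 + (‖x + y n‖ ^ 2)⁻¹ * ‖v n x - q x‖ ^ 2)) := fun n =>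
    ((iU n).const_mul 2).add (((iA n).add (K n).1).const_mul (2 * a))
  have hle : ∀ n x, a * ‖x + y n‖ ^ (-μ) * (Q x) ^ 2 ≤
      2 * (a * ‖x + y n‖ ^ (-μ) * ‖u n (x + y n)‖ ^ 2) +
      2 * a * (‖v n x - q x‖ ^ 2 + (‖x + y n‖ ^ 2)⁻¹ * ‖v n x - q x‖ ^ 2) := by
    intro n x
    have h1 := sq_add_bound (c n) (u n (x + y n)) (Q x) (hc1 n)
    have h2 := rpow_bound μ ‖x + y n‖ hμ1 hμ2 (norm_nonneg _)
    change Q x ^ 2 ≤ 2 * ‖u n (x + y n)‖ ^ 2 + 2 * ‖v n x - q x‖ ^ 2 at h1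
    have h3 : a * ‖x + y n‖ ^ (-μ) * (Q x) ^ 2 ≤ a * ‖x + y n‖ ^ (-μ) *
      (2 * ‖u n (x + y n)‖ ^ 2 + 2 * ‖v n x - q x‖ ^ 2) := by gcongr
    have h4 : 2 * a * ‖v n x - q x‖ ^ 2 * ‖x + y n‖ ^ (-μ) ≤
      2 * a * ‖v n x - q x‖ ^ 2 * (1 + (‖x + y n‖ ^ 2)⁻¹) := by gcongr
    linarith
  have hnn : ∀ n x, 0 ≤ a * ‖x + y n‖ ^ (-μ) * (Q x) ^ 2 := fun n x => by positivity
  have iQ : ∀ n, Integrable (fun x => a * ‖x + y n‖ ^ (-μ) * (Q x) ^ 2) := by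
    intro n
    refine (iR n).mono' ?_ (Eventually.of_forall fun x => ?_)
    · have := hQcont.measurable
      exact Measurable.aestronglyMeasurable (by fun_prop)
    · rw [Real.norm_of_nonneg (hnn n x)]
      exact hle n x
  have hQlim : Tendsto (fun n => ∫ x, a * ‖x + y n‖ ^ (-μ) * (Q x) ^ 2) atTop (nhds 0) := by
    refine squeeze_zero (g := fun n => 2 * pot a μ (u n) + 2 * a * ((∫ x, ‖v n x - q x‖ ^ 2)
      + 8 * ∫ x, ‖fderiv ℝ (v n) x - fderiv ℝ q x‖ ^ 2))
      (fun n => integral_nonneg (hnn n)) (fun n => ?_) ?_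
    · refine (integral_mono (iQ n) (iR n) (hle n)).trans ?_
      have i2 : Integrable (fun x => 2 * a * (‖v n x - q x‖ ^ 2 +
          (‖x + y n‖ ^ 2)⁻¹ * ‖v n x - q x‖ ^ 2)) := ((iA n).add (K n).1).const_mul (2 * a)
      rw [integral_add ((iU n).const_mul 2) i2,
        integral_const_mul, integral_const_mul, eU, integral_add (iA n) (K n).1]
      have := (K n).2
      gcongr
    · simpa using (hpot.const_mul 2).add ((hA.add (hB.const_mul 8)).const_mul (2 * a))
  refine ⟨hpot, ?_, final_step a μ ha hμ1 Q hQpos hQ2 y iQ hQlim⟩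
  have eQ : ∀ n, ∫ x, a * ‖x‖ ^ (-μ) * (Q (x - y n)) ^ 2 =
      ∫ x, a * ‖x + y n‖ ^ (-μ) * (Q x) ^ 2 := fun n => by
    rw [← integral_add_right_eq_self (fun x => a * ‖x‖ ^ (-μ) * (Q (x - y n)) ^ 2) (y n)]
    simp only [add_sub_cancel_right]
  simpa only [eQ] using hQlim
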